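/- For every integer n ≥ 2, the ladder L_n admits a super totally antimagic total labeling g that is moreover weak ordered; in fact the vertex set can be partitioned into the two classes {u_1,...,u_n} and {v_1,...,v_n} on each of which g is sharp ordered. -/

import Mathlib

open Sum

/-- The weight of an edge `e` under a total labeling `f` of the graph `G`:
the label of `e` plus the labels of its two endpoints. -/
noncomputable def edgeWt {V : Type*} (G : SimpleGraph V) (f : V ⊕ G.edgeSet → ℕ)
    (e : G.edgeSet) : ℕ :=
  f (inr e) + ∑ᶠ (v : V) (_ : v ∈ (e : Sym2 V)), f (inl v)

/-- The weight of a vertex `v` under a total labeling `f` of the graph `G`: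
the label of `v` plus the labels of all edges incident with `v`. -/
noncomputable def vertexWt {V : Type*} (G : SimpleGraph V) (f : V ⊕ G.edgeSet → ℕ)
    (v : V) : ℕ :=
  f (inl v) + ∑ᶠ (e : G.edgeSet) (_ : v ∈ (e : Sym2 V)), f (inr e)

/-- The ladder `L_n = P_n × P_2`, with vertices `u_i = inl i` and `v_i = inr i`
(`i` running over `Fin n`), edges `u_i u_{i+1}`, `v_i v_{i+1}` and rungs `u_i v_i`. -/
def ladder (n : ℕ) : SimpleGraph (Fin n ⊕ Fin n) :=
  SimpleGraph.fromRel (fun a b =>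
    (∃ p q : Fin n, (p : ℕ) + 1 = (q : ℕ) ∧ a = inl p ∧ b = inl q) ∨
    (∃ p q : Fin n, (p : ℕ) + 1 = (q : ℕ) ∧ a = inr p ∧ b = inr q) ∨
    (∃ p : Fin n, a = inl p ∧ b = inr p))

/-- The weight of the edge `s(a, b)`. -/
lemma edgeWt_mk {V : Type*} (G : SimpleGraph V) (f : V ⊕ G.edgeSet → ℕ) (a b : V)
    (h : s(a, b) ∈ G.edgeSet) :
    edgeWt G f ⟨s(a, b), h⟩ = f (inr ⟨s(a, b), h⟩) + (f (inl a) + f (inl b)) := by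
  have hab : a ≠ b := G.ne_of_adj h
  rw [edgeWt, ← finsum_mem_pair (f := fun v => f (inl v)) hab]
  simp

/-- A vertex weight as a sum over the neighbours of the vertex, for a labeling whose edge labels
come from a function on all unordered pairs. -/
lemma vertexWt_elim {V : Type*} [Fintype V] (G : SimpleGraph V) [DecidableRel G.Adj]
    (L : V → ℕ) (F : Sym2 V → ℕ) (v : V) :
    vertexWt G (Sum.elim L (fun e : G.edgeSet => F e)) v =
      L v + ∑ w : V, if G.Adj v w then F s(v, w) else 0 := by
  have h1 : ∑ᶠ (e : G.edgeSet) (_ : v ∈ (e : Sym2 V)), F e = ∑ᶠ e ∈ G.incidenceSet v, F e := by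
    rw [finsum_set_coe_eq_finsum_mem (f := fun e : Sym2 V => ∑ᶠ (_ : v ∈ e), F e) G.edgeSet]
    refine finsum_congr fun e => ?_
    by_cases he : e ∈ G.edgeSet <;> by_cases hv : v ∈ e <;>
      simp [SimpleGraph.incidenceSet, he, hv]
  have h2 : ∑ᶠ w ∈ G.neighborSet v, F s(v, w) = ∑ᶠ e ∈ G.incidenceSet v, F e := by
    refine finsum_mem_eq_of_bijOn (fun w => s(v, w)) ⟨?_, ?_, ?_⟩ fun _ _ => rfl
    · intro w hw
      exact ⟨hw, Sym2.mem_mk_left v w⟩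
    · intro w _ w' _ h
      exact Sym2.congr_right.mp h
    · rintro e ⟨he, hv⟩
      obtain ⟨w, rfl⟩ := hv
      exact ⟨w, he, rfl⟩
  simp only [vertexWt, Sum.elim_inl, Sum.elim_inr]
  rw [h1, ← h2, finsum_eq_sum_of_fintype]
  simp [finsum_eq_if]

lemma ladder_adj_inl_inl {n : ℕ} (p q : Fin n) :
    (ladder n).Adj (inl p) (inl q) ↔ (p : ℕ) + 1 = q ∨ (q : ℕ) + 1 = p := by
  simp only [ladder, SimpleGraph.fromRel_adj]
  simp
  rintro h rfl
  omega

lemma ladder_adj_inr_inr {n : ℕ} (p q : Fin n) :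
    (ladder n).Adj (inr p) (inr q) ↔ (p : ℕ) + 1 = q ∨ (q : ℕ) + 1 = p := by
  simp only [ladder, SimpleGraph.fromRel_adj]
  simp
  rintro h rfl
  omega

lemma ladder_adj_inl_inr {n : ℕ} (p q : Fin n) :
    (ladder n).Adj (inl p) (inr q) ↔ q = p := by
  simp [ladder, SimpleGraph.fromRel_adj]

lemma ladder_adj_inr_inl {n : ℕ} (p q : Fin n) :
    (ladder n).Adj (inr p) (inl q) ↔ q = p := by
  rw [SimpleGraph.adj_comm, ladder_adj_inl_inr, eq_comm]

/-- Every edge of the ladder lies on the first rail, on the second rail, or is a rung. -/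
lemma ladder_edge_cases {n : ℕ} {e : Sym2 (Fin n ⊕ Fin n)} (he : e ∈ (ladder n).edgeSet) :
    (∃ p q : Fin n, (p : ℕ) + 1 = q ∧ e = s(inl p, inl q)) ∨
    (∃ p : Fin n, e = s(inl p, inr p)) ∨
    (∃ p q : Fin n, (p : ℕ) + 1 = q ∧ e = s(inr p, inr q)) := by
  induction e with
  | _ a b =>
    rw [SimpleGraph.mem_edgeSet] at he
    rcases a with p | p <;> rcases b with q | q
    · rcases (ladder_adj_inl_inl p q).mp he with h | h
      · exact Or.inl ⟨p, q, h, rfl⟩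
      · exact Or.inl ⟨q, p, h, Sym2.eq_swap⟩
    · obtain rfl := (ladder_adj_inl_inr p q).mp he
      exact Or.inr (Or.inl ⟨q, rfl⟩)
    · obtain rfl := (ladder_adj_inr_inl p q).mp he
      exact Or.inr (Or.inl ⟨q, Sym2.eq_swap⟩)
    · rcases (ladder_adj_inr_inr p q).mp he with h | h
      · exact Or.inr (Or.inr ⟨p, q, h, rfl⟩)
      · exact Or.inr (Or.inr ⟨q, p, h, Sym2.eq_swap⟩)

/-- The sum of `h` over the neighbours of `p` in the path on `Fin n`. -/
lemma sum_path_neighbors {n : ℕ} (p : Fin n) (h : ℕ → ℕ) :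
    (∑ q : Fin n, if (p : ℕ) + 1 = q ∨ (q : ℕ) + 1 = p then h q else 0) =
      (if (p : ℕ) + 1 < n then h (p + 1) else 0) + if 0 < (p : ℕ) then h (p - 1) else 0 := by
  have hsplit : ∀ q : Fin n, (if (p : ℕ) + 1 = q ∨ (q : ℕ) + 1 = p then h q else 0) =
      (if (p : ℕ) + 1 = q then h q else 0) + if (q : ℕ) + 1 = p then h q else 0 := by
    intro q
    split_ifs <;> omega
  rw [Finset.sum_congr rfl fun q _ => hsplit q, Finset.sum_add_distrib]
  congr 1
  · split_ifs with hp
    · rw [Finset.sum_eq_single ⟨p + 1, hp⟩]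
      · simp
      · intro q _ hq
        exact if_neg fun hpq => hq (Fin.ext hpq.symm)
      · simp
    · exact Finset.sum_eq_zero fun q _ => if_neg (by omega)
  · split_ifs with hp
    · rw [Finset.sum_eq_single ⟨p - 1, by omega⟩]
      · exact if_pos (by simp only; omega)
      · intro q _ hq
        exact if_neg fun hpq => hq (Fin.ext (by simp only; omega))
      · simp
    · exact Finset.sum_eq_zero fun q _ => if_neg (by omega)

/-- The rank of the `p`-th vertex of a path on `n` vertices when the path is folded in the middle
and its vertices are listed from the ends inwards, alternating between the two halves. -/
def foldRank (n p : ℕ) : ℕ := if 2 * p < n then 2 * p else 2 * (n - 1 - p) + 1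

/-- The rank of the edge joining the vertices `p` and `p + 1` of the folded path. -/
def foldEdgeRank (n p : ℕ) : ℕ := min (foldRank n p) (foldRank n (p + 1))

lemma foldRank_lt {n p : ℕ} (hp : p < n) : foldRank n p < n := by
  unfold foldRank; split_ifs <;> omega

lemma foldRank_inj {n p q : ℕ} (hp : p < n) (hq : q < n) (h : foldRank n p = foldRank n q) :
    p = q := by
  unfold foldRank at h; split_ifs at h <;> omega

lemma exists_foldRank_eq {n k : ℕ} (hk : k < n) : ∃ p < n, foldRank n p = k := by
  refine ⟨if k % 2 = 0 then k / 2 else n - 1 - k / 2, ?_, ?_⟩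
  · split_ifs <;> omega
  · unfold foldRank; split_ifs <;> omega

lemma foldEdgeRank_lt {n p : ℕ} (hp : p + 1 < n) : foldEdgeRank n p + 1 < n := by
  unfold foldEdgeRank foldRank; split_ifs <;> omega

lemma foldEdgeRank_inj {n p q : ℕ} (hp : p + 1 < n) (hq : q + 1 < n)
    (h : foldEdgeRank n p = foldEdgeRank n q) : p = q := by
  unfold foldEdgeRank foldRank at h; split_ifs at h <;> omega

lemma exists_foldEdgeRank_eq {n k : ℕ} (hk : k + 1 < n) :
    ∃ p, p + 1 < n ∧ foldEdgeRank n p = k := by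
  refine ⟨if k % 2 = 0 then k / 2 else n - 2 - k / 2, ?_, ?_⟩
  · split_ifs <;> omega
  · unfold foldEdgeRank foldRank; split_ifs <;> omega

lemma foldRank_add_foldRank {n p : ℕ} (hp : p + 1 < n) :
    foldRank n p + foldRank n (p + 1) =
      foldEdgeRank n p + min (foldEdgeRank n p + 2) (n - 1) := by
  unfold foldEdgeRank foldRank; split_ifs <;> omega

/-- The labels `2 foldRank + 1` and `2 foldRank + 2` on the two rails of the ladder. -/
def ladderVertexLabel (n : ℕ) : Fin n ⊕ Fin n → ℕ
  | inl p => 2 * foldRank n p + 1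
  | inr p => 2 * foldRank n p + 2

/-- The label of the rung joining two vertices of rank `k`. -/
def rungLabel (n k : ℕ) : ℕ :=
  if k = 0 then 2 * n + 1 else if k + 1 = n then 5 * n - 2 else 2 * n + 3 * k

/-- The label of the edge of rank `k` on the first rail. -/
def leftRailLabel (n k : ℕ) : ℕ := 2 * n + 2 + 3 * k

/-- The label of the edge of rank `k` on the second rail. -/
def rightRailLabel (n k : ℕ) : ℕ := if k + 2 = n then 5 * n - 3 else 2 * n + 4 + 3 * k

/-- The label of the edge with the given ends, in terms of the smaller rank of its ends. -/
def ladderEdgeLabel (n : ℕ) : Sym2 (Fin n ⊕ Fin n) → ℕ :=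
  Sym2.lift ⟨fun a b => match a, b with
    | inl p, inl q => leftRailLabel n (min (foldRank n p) (foldRank n q))
    | inr p, inr q => rightRailLabel n (min (foldRank n p) (foldRank n q))
    | inl p, inr q => rungLabel n (min (foldRank n p) (foldRank n q))
    | inr p, inl q => rungLabel n (min (foldRank n p) (foldRank n q)), by
    rintro (p | p) (q | q) <;> simp only [min_comm]⟩

/-- The total labeling of the ladder in which all edge weights and all vertex weights increase
along the folded ladder. -/
def ladderLabeling (n : ℕ) : (Fin n ⊕ Fin n) ⊕ (ladder n).edgeSet → ℕ :=
  Sum.elim (ladderVertexLabel n) (fun e => ladderEdgeLabel n e)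

lemma ladderEdgeLabel_inl {n : ℕ} {p q : Fin n} (h : (p : ℕ) + 1 = q) :
    ladderEdgeLabel n s(inl p, inl q) = leftRailLabel n (foldEdgeRank n p) := by
  simp [ladderEdgeLabel, foldEdgeRank, h]

lemma ladderEdgeLabel_inr {n : ℕ} {p q : Fin n} (h : (p : ℕ) + 1 = q) :
    ladderEdgeLabel n s(inr p, inr q) = rightRailLabel n (foldEdgeRank n p) := by
  simp [ladderEdgeLabel, foldEdgeRank, h]

lemma ladderEdgeLabel_rung {n : ℕ} (p : Fin n) :
    ladderEdgeLabel n s(inl p, inr p) = rungLabel n (foldRank n p) := by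
  simp [ladderEdgeLabel]

lemma ladderVertexLabel_injective (n : ℕ) : Function.Injective (ladderVertexLabel n) := by
  rintro (p | p) (q | q) h <;> simp only [ladderVertexLabel] at h
  · exact congrArg inl (Fin.ext (foldRank_inj p.2 q.2 (by omega)))
  · omega
  · omega
  · exact congrArg inr (Fin.ext (foldRank_inj p.2 q.2 (by omega)))

lemma ladderVertexLabel_bijOn (n : ℕ) :
    Set.BijOn (ladderVertexLabel n) Set.univ (Set.Icc 1 (2 * n)) := by
  refine ⟨?_, (ladderVertexLabel_injective n).injOn, ?_⟩
  · rintro (p | p) - <;> have := foldRank_lt p.2 <;>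
      simp only [ladderVertexLabel, Set.mem_Icc] <;> omega
  · rintro m ⟨h1, h2⟩
    obtain ⟨p, hp, hk⟩ := exists_foldRank_eq (n := n) (k := (m - 1) / 2) (by omega)
    rcases Nat.mod_two_eq_zero_or_one m with hm | hm
    · exact ⟨inr ⟨p, hp⟩, trivial, by simp only [ladderVertexLabel]; omega⟩
    · exact ⟨inl ⟨p, hp⟩, trivial, by simp only [ladderVertexLabel]; omega⟩

lemma ladderEdgeLabel_injOn (n : ℕ) : Set.InjOn (ladderEdgeLabel n) (ladder n).edgeSet := by
  intro e he e' he' h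
  rcases ladder_edge_cases he with ⟨p, q, hpq, rfl⟩ | ⟨p, rfl⟩ | ⟨p, q, hpq, rfl⟩ <;>
  rcases ladder_edge_cases he' with ⟨p', q', hpq', rfl⟩ | ⟨p', rfl⟩ | ⟨p', q', hpq', rfl⟩
  · rw [ladderEdgeLabel_inl hpq, ladderEdgeLabel_inl hpq'] at h
    have hk := foldEdgeRank_lt (n := n) (p := p) (by omega)
    have hk' := foldEdgeRank_lt (n := n) (p := p') (by omega)
    obtain rfl : p = p' := Fin.ext (foldEdgeRank_inj (n := n) (by omega) (by omega) (by
      unfold leftRailLabel at h; omega))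
    obtain rfl : q = q' := Fin.ext (by omega)
    rfl
  · rw [ladderEdgeLabel_inl hpq, ladderEdgeLabel_rung] at h
    have hk := foldEdgeRank_lt (n := n) (p := p) (by omega)
    have hk' := foldRank_lt p'.2
    unfold leftRailLabel rungLabel at h
    split_ifs at h <;> omega
  · rw [ladderEdgeLabel_inl hpq, ladderEdgeLabel_inr hpq'] at h
    have hk := foldEdgeRank_lt (n := n) (p := p) (by omega)
    have hk' := foldEdgeRank_lt (n := n) (p := p') (by omega)
    unfold leftRailLabel rightRailLabel at h
    split_ifs at h <;> omega
  · rw [ladderEdgeLabel_rung, ladderEdgeLabel_inl hpq'] at h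
    have hk := foldRank_lt p.2
    have hk' := foldEdgeRank_lt (n := n) (p := p') (by omega)
    unfold rungLabel leftRailLabel at h
    split_ifs at h <;> omega
  · rw [ladderEdgeLabel_rung, ladderEdgeLabel_rung] at h
    have hk := foldRank_lt p.2
    have hk' := foldRank_lt p'.2
    obtain rfl : p = p' := Fin.ext (foldRank_inj p.2 p'.2 (by
      unfold rungLabel at h; split_ifs at h <;> omega))
    rfl
  · rw [ladderEdgeLabel_rung, ladderEdgeLabel_inr hpq'] at h
    have hk := foldRank_lt p.2
    have hk' := foldEdgeRank_lt (n := n) (p := p') (by omega)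
    unfold rungLabel rightRailLabel at h
    split_ifs at h <;> omega
  · rw [ladderEdgeLabel_inr hpq, ladderEdgeLabel_inl hpq'] at h
    have hk := foldEdgeRank_lt (n := n) (p := p) (by omega)
    have hk' := foldEdgeRank_lt (n := n) (p := p') (by omega)
    unfold rightRailLabel leftRailLabel at h
    split_ifs at h <;> omega
  · rw [ladderEdgeLabel_inr hpq, ladderEdgeLabel_rung] at h
    have hk := foldEdgeRank_lt (n := n) (p := p) (by omega)
    have hk' := foldRank_lt p'.2
    unfold rightRailLabel rungLabel at h
    split_ifs at h <;> omega
  · rw [ladderEdgeLabel_inr hpq, ladderEdgeLabel_inr hpq'] at h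
    have hk := foldEdgeRank_lt (n := n) (p := p) (by omega)
    have hk' := foldEdgeRank_lt (n := n) (p := p') (by omega)
    obtain rfl : p = p' := Fin.ext (foldEdgeRank_inj (n := n) (by omega) (by omega) (by
      unfold rightRailLabel at h; split_ifs at h <;> omega))
    obtain rfl : q = q' := Fin.ext (by omega)
    rfl

lemma ladderEdgeLabel_bijOn {n : ℕ} (hn : 2 ≤ n) :
    Set.BijOn (ladderEdgeLabel n) (ladder n).edgeSet (Set.Icc (2 * n + 1) (5 * n - 2)) := by
  refine ⟨?_, ladderEdgeLabel_injOn n, ?_⟩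
  · intro e he
    rcases ladder_edge_cases he with ⟨p, q, hpq, rfl⟩ | ⟨p, rfl⟩ | ⟨p, q, hpq, rfl⟩
    · have := foldEdgeRank_lt (n := n) (p := p) (by omega)
      rw [ladderEdgeLabel_inl hpq, leftRailLabel, Set.mem_Icc]; omega
    · have := foldRank_lt p.2
      rw [ladderEdgeLabel_rung, rungLabel, Set.mem_Icc]; split_ifs <;> omega
    · have := foldEdgeRank_lt (n := n) (p := p) (by omega)
      rw [ladderEdgeLabel_inr hpq, rightRailLabel, Set.mem_Icc]; split_ifs <;> omega
  · have left : ∀ k, k + 1 < n →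
        leftRailLabel n k ∈ ladderEdgeLabel n '' (ladder n).edgeSet := by
      intro k hk
      obtain ⟨p, hp, rfl⟩ := exists_foldEdgeRank_eq hk
      exact ⟨s(inl ⟨p, by omega⟩, inl ⟨p + 1, hp⟩), (ladder_adj_inl_inl _ _).mpr (Or.inl rfl),
        ladderEdgeLabel_inl rfl⟩
    have rung : ∀ k < n, rungLabel n k ∈ ladderEdgeLabel n '' (ladder n).edgeSet := by
      intro k hk
      obtain ⟨p, hp, rfl⟩ := exists_foldRank_eq hk
      exact ⟨s(inl ⟨p, hp⟩, inr ⟨p, hp⟩), (ladder_adj_inl_inr _ _).mpr rfl,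
        ladderEdgeLabel_rung _⟩
    have right : ∀ k, k + 1 < n →
        rightRailLabel n k ∈ ladderEdgeLabel n '' (ladder n).edgeSet := by
      intro k hk
      obtain ⟨p, hp, rfl⟩ := exists_foldEdgeRank_eq hk
      exact ⟨s(inr ⟨p, by omega⟩, inr ⟨p + 1, hp⟩), (ladder_adj_inr_inr _ _).mpr (Or.inl rfl),
        ladderEdgeLabel_inr rfl⟩
    rintro m ⟨h1, h2⟩
    obtain h | h | h | h : m = 2 * n + 1 ∨ m = 5 * n - 2 ∨ m = 5 * n - 3 ∧ 2 * n + 1 < m ∨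
      (2 * n + 1 < m ∧ m < 5 * n - 3) := by omega
    · simpa [h, rungLabel] using rung 0 (by omega)
    · convert rung (n - 1) (by omega) using 1
      unfold rungLabel; split_ifs <;> omega
    · convert right (n - 2) (by omega) using 1
      unfold rightRailLabel; split_ifs <;> omega
    obtain ⟨k, hk, rfl | rfl | rfl⟩ : ∃ k, k + 1 < n ∧ (m = 2 * n + 2 + 3 * k ∨
        m = 2 * n + 3 * (k + 1) ∨ m = 2 * n + 4 + 3 * k) :=
      ⟨(m - 2 * n - 2) / 3, by omega, by omega⟩
    · exact left k (by omega)
    · have hrung : rungLabel n (k + 1) = 2 * n + 3 * (k + 1) := by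
        rw [rungLabel, if_neg (by omega), if_neg (by omega)]
      exact hrung ▸ rung (k + 1) (by omega)
    · convert right k (by omega) using 1
      unfold rightRailLabel; split_ifs <;> omega

lemma ladderLabeling_bijOn {n : ℕ} (hn : 2 ≤ n) :
    Set.BijOn (ladderLabeling n) Set.univ (Set.Icc 1 (5 * n - 2)) := by
  have hV := ladderVertexLabel_bijOn n
  have hE := ladderEdgeLabel_bijOn hn
  refine ⟨?_, ?_, ?_⟩
  · rintro (v | e) -
    · have h := Set.mem_Icc.mp (hV.mapsTo (Set.mem_univ v))
      exact Set.mem_Icc.mpr ⟨h.1, h.2.trans (by omega)⟩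
    · have h := Set.mem_Icc.mp (hE.mapsTo e.2)
      exact Set.mem_Icc.mpr ⟨le_trans (by omega) h.1, h.2⟩
  · refine (Function.Injective.sumElim (ladderVertexLabel_injective n) ?_ ?_).injOn
    · intro e e' h
      exact Subtype.ext (hE.injOn e.2 e'.2 h)
    · intro v e
      have h := Set.mem_Icc.mp (hV.mapsTo (Set.mem_univ v))
      have h' := Set.mem_Icc.mp (hE.mapsTo e.2)
      omega
  · rintro m ⟨h1, h2⟩
    rcases le_or_gt m (2 * n) with h | h
    · obtain ⟨v, -, hv⟩ := hV.surjOn ⟨h1, h⟩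
      exact ⟨inl v, trivial, hv⟩
    · obtain ⟨e, he, hm⟩ := hE.surjOn ⟨h, h2⟩
      exact ⟨inr ⟨e, he⟩, trivial, hm⟩

/-- The label and the weight of an edge of the ladder, in terms of its rank. -/
lemma edgeWt_ladderLabeling_cases {n : ℕ} (e : (ladder n).edgeSet) :
    (∃ k, k + 1 < n ∧ ladderEdgeLabel n e = leftRailLabel n k ∧
      edgeWt (ladder n) (ladderLabeling n) e =
        leftRailLabel n k + (2 * (k + min (k + 2) (n - 1)) + 2)) ∨
    (∃ k < n, ladderEdgeLabel n e = rungLabel n k ∧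
      edgeWt (ladder n) (ladderLabeling n) e = rungLabel n k + (4 * k + 3)) ∨
    (∃ k, k + 1 < n ∧ ladderEdgeLabel n e = rightRailLabel n k ∧
      edgeWt (ladder n) (ladderLabeling n) e =
        rightRailLabel n k + (2 * (k + min (k + 2) (n - 1)) + 4)) := by
  obtain ⟨e, he⟩ := e
  rcases ladder_edge_cases he with ⟨p, q, hpq, rfl⟩ | ⟨p, rfl⟩ | ⟨p, q, hpq, rfl⟩ <;>
    rw [edgeWt_mk] <;>
    simp only [ladderLabeling, Sum.elim_inl, Sum.elim_inr, ladderVertexLabel]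
  · have hp : (p : ℕ) + 1 < n := by omega
    have h := foldRank_add_foldRank hp
    rw [hpq] at h
    refine Or.inl ⟨foldEdgeRank n p, foldEdgeRank_lt hp, ladderEdgeLabel_inl hpq, ?_⟩
    rw [ladderEdgeLabel_inl hpq]
    omega
  · refine Or.inr (Or.inl ⟨foldRank n p, foldRank_lt p.2, ladderEdgeLabel_rung p, ?_⟩)
    rw [ladderEdgeLabel_rung]
    omega
  · have hp : (p : ℕ) + 1 < n := by omega
    have h := foldRank_add_foldRank hp
    rw [hpq] at h
    refine Or.inr (Or.inr ⟨foldEdgeRank n p, foldEdgeRank_lt hp, ladderEdgeLabel_inr hpq, ?_⟩)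
    rw [ladderEdgeLabel_inr hpq]
    omega

lemma edgeWt_ladderLabeling_injective (n : ℕ) :
    Function.Injective (edgeWt (ladder n) (ladderLabeling n)) := by
  intro e e' h
  refine Subtype.ext (ladderEdgeLabel_injOn n e.2 e'.2 ?_)
  rcases edgeWt_ladderLabeling_cases e with ⟨k, hk, hL, hW⟩ | ⟨k, hk, hL, hW⟩ | ⟨k, hk, hL, hW⟩ <;>
  rcases edgeWt_ladderLabeling_cases e' with
    ⟨k', hk', hL', hW'⟩ | ⟨k', hk', hL', hW'⟩ | ⟨k', hk', hL', hW'⟩ <;>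
  rw [hW, hW'] at h <;> rw [hL, hL'] <;> clear hL hL' hW hW' <;>
  simp only [leftRailLabel, rungLabel, rightRailLabel] at h ⊢ <;>
  grind

/-- The total of the labels of the edges of one rail at its vertex `p`, if `l k` is the label of
the edge of rank `k`. -/
def railSum (n : ℕ) (l : ℕ → ℕ) (p : ℕ) : ℕ :=
  (if p + 1 < n then l (foldEdgeRank n p) else 0) + if 0 < p then l (foldEdgeRank n (p - 1)) else 0

lemma railSum_eq_sum {n : ℕ} (l : ℕ → ℕ) (p : Fin n) :
    (∑ q : Fin n, if (p : ℕ) + 1 = q ∨ (q : ℕ) + 1 = p then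
      l (min (foldRank n p) (foldRank n q)) else 0) = railSum n l p := by
  rw [sum_path_neighbors p fun q => l (min (foldRank n p) (foldRank n q)), railSum]
  congr 1
  split_ifs with hp
  · rw [foldEdgeRank, min_comm, Nat.sub_add_cancel hp]
  · rfl

/-- The rail edges at a vertex of rank `k` have ranks `min k (n - 2)` and, if `2 ≤ k`, `k - 2`. -/
lemma railSum_eq {n : ℕ} (l : ℕ → ℕ) {p : ℕ} (hn : 2 ≤ n) (hp : p < n) :
    railSum n l p = l (min (foldRank n p) (n - 2)) +
      if 2 ≤ foldRank n p then l (foldRank n p - 2) else 0 := by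
  unfold railSum foldEdgeRank foldRank
  grind

/-- The weight of the vertex of rank `k` on a rail with edge labels `l`, if the vertex has label
`2 * k + c`. -/
def rankWt (n c : ℕ) (l : ℕ → ℕ) (k : ℕ) : ℕ :=
  2 * k + c + (l (min k (n - 2)) + (if 2 ≤ k then l (k - 2) else 0) + rungLabel n k)

lemma vertexWt_ladderLabeling_inl {n : ℕ} (hn : 2 ≤ n) (p : Fin n) :
    vertexWt (ladder n) (ladderLabeling n) (inl p) =
      rankWt n 1 (leftRailLabel n) (foldRank n p) := by
  classical
  rw [ladderLabeling, vertexWt_elim, Fintype.sum_sum_type, rankWt, ← railSum_eq _ hn p.2,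
    ← railSum_eq_sum]
  simp [ladder_adj_inl_inl, ladder_adj_inl_inr, ladderVertexLabel, ladderEdgeLabel]

lemma vertexWt_ladderLabeling_inr {n : ℕ} (hn : 2 ≤ n) (p : Fin n) :
    vertexWt (ladder n) (ladderLabeling n) (inr p) =
      rankWt n 2 (rightRailLabel n) (foldRank n p) := by
  classical
  rw [ladderLabeling, vertexWt_elim, Fintype.sum_sum_type, rankWt, ← railSum_eq _ hn p.2,
    ← railSum_eq_sum, add_comm (∑ q : Fin n, _) (rungLabel _ _)]
  simp [ladder_adj_inr_inr, ladder_adj_inr_inl, ladderVertexLabel, ladderEdgeLabel]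

lemma rankWt_left_lt_right {n : ℕ} (hn : 2 ≤ n) (k : ℕ) :
    rankWt n 1 (leftRailLabel n) k < rankWt n 2 (rightRailLabel n) k := by
  unfold rankWt leftRailLabel rightRailLabel
  split_ifs <;> omega

lemma rankWt_right_lt_left_succ {n k : ℕ} (hk : k + 1 < n) :
    rankWt n 2 (rightRailLabel n) k < rankWt n 1 (leftRailLabel n) (k + 1) := by
  unfold rankWt leftRailLabel rightRailLabel rungLabel
  grind

lemma rankWt_right_lt_left {n j k : ℕ} (hjk : j < k) (hk : k < n) :
    rankWt n 2 (rightRailLabel n) j < rankWt n 1 (leftRailLabel n) k := by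
  induction k, hjk using Nat.le_induction with
  | base => exact rankWt_right_lt_left_succ hk
  | succ k hjk ih =>
    exact (ih (by omega)).trans
      ((rankWt_left_lt_right (by omega) k).trans (rankWt_right_lt_left_succ hk))

/-- Vertex weights are strictly increasing in the vertex labels. -/
lemma vertexWt_ladderLabeling_lt {n : ℕ} (hn : 2 ≤ n) {v w : Fin n ⊕ Fin n}
    (h : ladderVertexLabel n v < ladderVertexLabel n w) :
    vertexWt (ladder n) (ladderLabeling n) v < vertexWt (ladder n) (ladderLabeling n) w := by
  rcases v with p | p <;> rcases w with q | q <;>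
  simp only [ladderVertexLabel] at h <;>
  simp only [vertexWt_ladderLabeling_inl hn, vertexWt_ladderLabeling_inr hn]
  · exact (rankWt_left_lt_right hn _).trans
      (rankWt_right_lt_left (by omega) (foldRank_lt q.2))
  · rcases (by omega : foldRank n p ≤ foldRank n q).eq_or_lt with hpq | hpq
    · rw [hpq]
      exact rankWt_left_lt_right hn _
    · exact (rankWt_left_lt_right hn _).trans
        ((rankWt_right_lt_left hpq (foldRank_lt q.2)).trans
          (rankWt_left_lt_right hn _))
  · exact rankWt_right_lt_left (by omega) (foldRank_lt q.2)
  · exact (rankWt_right_lt_left (by omega) (foldRank_lt q.2)).trans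
      (rankWt_left_lt_right hn _)

/-- For every `n ≥ 2` the ladder `L_n` admits a super totally antimagic total labeling
which is moreover sharp ordered on each of the two classes `{u_1,…,u_n}` and
`{v_1,…,v_n}` (hence weak ordered). -/
theorem ladder_weak_ordered_super_TAT (n : ℕ) (hn : 2 ≤ n) :
    ∃ g : (Fin n ⊕ Fin n) ⊕ (ladder n).edgeSet → ℕ,
      -- `g` is a total labeling: a bijection onto `{1, …, 5n-2}`
      Set.BijOn g Set.univ (Set.Icc 1 (5 * n - 2)) ∧
      -- `g` is super: the vertices receive exactly the labels `{1, …, 2n}`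
      Set.BijOn (fun v => g (inl v)) Set.univ (Set.Icc 1 (2 * n)) ∧
      -- `g` is edge-antimagic total
      Function.Injective (edgeWt (ladder n) g) ∧
      -- `g` is vertex-antimagic total
      Function.Injective (vertexWt (ladder n) g) ∧
      -- `g` is sharp ordered on the class `{u_1, …, u_n}`
      (∀ i j : Fin n, g (inl (inl i)) < g (inl (inl j)) →
        vertexWt (ladder n) g (inl i) < vertexWt (ladder n) g (inl j)) ∧
      -- `g` is sharp ordered on the class `{v_1, …, v_n}`
      (∀ i j : Fin n, g (inl (inr i)) < g (inl (inr j)) →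
        vertexWt (ladder n) g (inr i) < vertexWt (ladder n) g (inr j)) := by
  refine ⟨ladderLabeling n, ladderLabeling_bijOn hn, ladderVertexLabel_bijOn n,
    edgeWt_ladderLabeling_injective n, ?_, fun i j h => vertexWt_ladderLabeling_lt hn h,
    fun i j h => vertexWt_ladderLabeling_lt hn h⟩
  intro v w h
  by_contra hvw
  rcases lt_or_gt_of_ne ((ladderVertexLabel_injective n).ne hvw) with hlt | hlt
  · exact (vertexWt_ladderLabeling_lt hn hlt).ne h
  · exact (vertexWt_ladderLabeling_lt hn hlt).ne' h
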